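/- For every real number x with 0 ≤ x < 1, the series ∑_{D=1}^{∞} (D^{D+3}/D!)·(x·e^{−x})^D converges and its sum equals (x + 8x^2 + 6x^3)/(1−x)^7. -/

import Mathlib

/-- Abel-type series: `∑ n ^ (n + k) / n! * y ^ n`, convergent for `|y| < e⁻¹`. -/
noncomputable def treeSeries (k : ℕ) (y : ℝ) : ℝ :=
  ∑' n : ℕ, (n : ℝ) ^ (n + k) / n.factorial * y ^ n

theorem summable_treeSeries (k : ℕ) {y : ℝ} (hy : |y| < Real.exp (-1)) :
    Summable fun n : ℕ => (n : ℝ) ^ (n + k) / n.factorial * y ^ n := by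
  have hr : ‖Real.exp 1 * |y|‖ < 1 := by
    rw [Real.norm_of_nonneg (by positivity)]
    calc Real.exp 1 * |y| < Real.exp 1 * Real.exp (-1) := by gcongr
      _ = 1 := by rw [← Real.exp_add]; simp
  refine (summable_pow_mul_geometric_of_norm_lt_one k hr).of_norm_bounded fun n => ?_
  have h := Real.pow_div_factorial_le_exp n (Nat.cast_nonneg n) n
  have e : Real.exp (n : ℝ) = Real.exp 1 ^ n := by rw [← Real.exp_nat_mul, mul_one]
  rw [norm_mul, norm_pow, Real.norm_of_nonneg (by positivity), Real.norm_eq_abs, mul_pow, ← e]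
  calc (n : ℝ) ^ (n + k) / n.factorial * |y| ^ n
      = (n : ℝ) ^ k * ((n : ℝ) ^ n / n.factorial * |y| ^ n) := by rw [pow_add]; ring
    _ ≤ _ := by gcongr

theorem hasDerivAt_treeSeries (k : ℕ) {y : ℝ} (hy : |y| < Real.exp (-1)) (hy0 : y ≠ 0) :
    HasDerivAt (treeSeries k) (treeSeries (k + 1) y / y) y := by
  obtain ⟨r, hyr, hr⟩ := exists_between hy
  have hr0 : 0 < r := (abs_nonneg y).trans_lt hyr
  have hterm : ∀ (n : ℕ) (z : ℝ), z ≠ 0 →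
      (n : ℝ) ^ (n + k) / n.factorial * (n * z ^ (n - 1)) =
        (n : ℝ) ^ (n + (k + 1)) / n.factorial * z ^ n / z := by
    rintro (_ | n) z hz
    · simp
    · rw [Nat.add_sub_cancel]
      field_simp
      ring
  have hu : Summable fun n : ℕ => (n : ℝ) ^ (n + k) / n.factorial * (n * r ^ (n - 1)) := by
    simp_rw [fun n => hterm n r hr0.ne']
    exact (summable_treeSeries (k + 1) (by rwa [abs_of_pos hr0])).div_const r
  have h := hasDerivAt_tsum_of_isPreconnected (t := Set.Ioo (-r) r) (y := y) (y₀ := y)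
    (g := fun (n : ℕ) z => (n : ℝ) ^ (n + k) / n.factorial * z ^ n)
    (g' := fun n z => (n : ℝ) ^ (n + k) / n.factorial * (n * z ^ (n - 1)))
    hu isOpen_Ioo isPreconnected_Ioo
    (fun n z _ => (hasDerivAt_pow n z).const_mul _)
    (fun n z hz => by
      have hz' : |z| ≤ r := (abs_lt.2 hz).le
      rw [norm_mul, norm_mul, norm_pow, Real.norm_of_nonneg (by positivity),
        Real.norm_of_nonneg (Nat.cast_nonneg n), Real.norm_eq_abs]
      gcongr)
    (abs_lt.1 hyr) (summable_treeSeries k hy) (abs_lt.1 hyr)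
  simp_rw [fun n => hterm n y hy0, tsum_div_const] at h
  exact h

theorem analyticAt_treeSeries (k : ℕ) {y : ℝ} (hy : |y| < Real.exp (-1)) :
    AnalyticAt ℝ (treeSeries k) y := by
  obtain ⟨r, hyr, hr⟩ := exists_between hy
  have hr0 : 0 < r := (abs_nonneg y).trans_lt hyr
  lift r to NNReal using hr0.le
  set c : ℕ → ℝ := fun n => (n : ℝ) ^ (n + k) / n.factorial
  have hrad : (r : ENNReal) ≤
      (FormalMultilinearSeries.ofScalars ℝ c).radius := by
    apply FormalMultilinearSeries.le_radius_of_summable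
    simp_rw [FormalMultilinearSeries.ofScalars_norm]
    convert! summable_treeSeries k (y := r) (by rwa [abs_of_pos hr0]) using 3 with n
    exact Real.norm_of_nonneg (by positivity)
  have hrad0 : 0 < (FormalMultilinearSeries.ofScalars ℝ c).radius :=
    lt_of_lt_of_le (by exact_mod_cast hr0) hrad
  have hsum : treeSeries k = (FormalMultilinearSeries.ofScalars ℝ c).sum := by
    rw [← FormalMultilinearSeries.ofScalarsSum, FormalMultilinearSeries.ofScalarsSum_eq_tsum]
    rfl
  rw [hsum]
  refine (FormalMultilinearSeries.hasFPowerSeriesOnBall _ hrad0).analyticOnNhd y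
    (Metric.eball_subset_eball hrad ?_)
  rw [Metric.eball_coe]
  simpa using hyr

theorem sum_antidiagonal_pow_mul_neg_pow (N : ℕ) :
    ∑ p ∈ Finset.HasAntidiagonal.antidiagonal N,
      (p.1 : ℝ) ^ p.1 / p.1.factorial * ((-p.1 : ℝ) ^ p.2 / p.2.factorial) = 1 := by
  have h := congrFun (fwdDiff_iter_eq_factorial (R := ℝ) (n := N)) 0
  rw [fwdDiff_iter_eq_sum_shift] at h
  rw [Finset.Nat.sum_antidiagonal_eq_sum_range_succ_mk]
  have hN : (N.factorial : ℝ) ≠ 0 := by positivity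
  apply mul_left_cancel₀ hN
  rw [mul_one, Finset.mul_sum]
  refine Eq.trans (Finset.sum_congr rfl fun d hd => ?_) h
  have hd' : d ≤ N := Nat.lt_succ_iff.1 (Finset.mem_range.1 hd)
  rw [neg_pow (d : ℝ)]
  have hpow : (d : ℝ) ^ N = (d : ℝ) ^ d * (d : ℝ) ^ (N - d) := by
    rw [← pow_add, Nat.add_sub_cancel' hd']
  simp only [zsmul_eq_mul, nsmul_eq_mul, mul_one, zero_add]
  push_cast
  rw [hpow, Nat.cast_choose ℝ hd']
  field_simp

theorem treeSeries_zero_of_lt_one_eighth {x : ℝ} (hx0 : 0 < x) (hx : x < 1 / 8) :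
    treeSeries 0 (x * Real.exp (-x)) = 1 / (1 - x) := by
  set f : ℕ × ℕ → ℝ := fun p =>
    (p.1 : ℝ) ^ p.1 / p.1.factorial * x ^ p.1 * ((-(p.1 * x)) ^ p.2 / p.2.factorial) with hf
  have hexp (z : ℝ) : HasSum (fun m : ℕ => z ^ m / m.factorial) (Real.exp z) := by
    rw [Real.exp_eq_exp_ℝ]
    exact NormedSpace.expSeries_div_hasSum_exp z
  have hfiber (n : ℕ) : HasSum (fun m => f (n, m))
      ((n : ℝ) ^ (n + 0) / n.factorial * (x * Real.exp (-x)) ^ n) := by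
    convert! (hexp (-(n * x))).mul_left ((n : ℝ) ^ n / n.factorial * x ^ n) using 1
    rw [add_zero, mul_pow, ← Real.exp_nat_mul, mul_neg]
    ring
  have hfiberAbs (n : ℕ) : HasSum (fun m => ‖f (n, m)‖)
      ((n : ℝ) ^ (n + 0) / n.factorial * (x * Real.exp x) ^ n) := by
    convert! (hexp (n * x)).mul_left ((n : ℝ) ^ n / n.factorial * x ^ n) using 1
    · ext m
      simp [hf, abs_of_pos hx0]
    · rw [add_zero, mul_pow, ← Real.exp_nat_mul]
      ring
  have hsmall : |x * Real.exp x| < Real.exp (-1) := by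
    rw [abs_of_pos (by positivity)]
    have h1 : Real.exp x < Real.exp 1 := Real.exp_lt_exp.2 (by linarith)
    have h2 := Real.exp_one_lt_d9
    have h3 : Real.exp (-1) * Real.exp 1 = 1 := by rw [← Real.exp_add]; simp
    have h4 := Real.exp_pos 1
    have h5 := Real.exp_pos (-1)
    have h6 : x * Real.exp x < 1 / 8 * Real.exp 1 :=
      mul_lt_mul'' hx h1 hx0.le (Real.exp_pos x).le
    nlinarith
  have hsummable : Summable f := by
    refine Summable.of_norm ((summable_prod_of_nonneg fun _ => norm_nonneg _).2
      ⟨fun n => (hfiberAbs n).summable, ?_⟩)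
    simp_rw [fun n => (hfiberAbs n).tsum_eq]
    exact summable_treeSeries 0 hsmall
  have hrows := hsummable.hasSum.prod_fiberwise hfiber
  have hdiag := (Finset.HasAntidiagonal.sigmaAntidiagonalEquivProd.hasSum_iff.2
    hsummable.hasSum).sigma (fun N => hasSum_fintype _)
  have hgeom : HasSum (fun N : ℕ => x ^ N) (∑' p, f p) := by
    convert! hdiag using 1
    ext N
    simp only [Function.comp_apply, Finset.HasAntidiagonal.sigmaAntidiagonalEquivProd_apply]
    rw [Finset.sum_coe_sort (Finset.HasAntidiagonal.antidiagonal N) f, ← mul_one (x ^ N),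
      ← sum_antidiagonal_pow_mul_neg_pow N, Finset.mul_sum]
    refine Finset.sum_congr rfl fun p hp => ?_
    rw [← Finset.HasAntidiagonal.mem_antidiagonal.1 hp, pow_add]
    simp only [hf]
    rw [← neg_mul, mul_pow]
    ring
  rw [treeSeries, hrows.tsum_eq, one_div]
  exact hgeom.unique (hasSum_geometric_of_lt_one hx0.le (by linarith))

theorem abs_mul_exp_neg_lt {x : ℝ} (hx0 : 0 ≤ x) (hx1 : x < 1) :
    |x * Real.exp (-x)| < Real.exp (-1) := by
  rw [abs_of_nonneg (by positivity)]
  have h := Real.add_one_lt_exp (x := x - 1) (by linarith)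
  calc x * Real.exp (-x) < Real.exp (x - 1) * Real.exp (-x) := by gcongr; linarith
    _ = Real.exp (-1) := by rw [← Real.exp_add]; ring_nf

theorem treeSeries_zero_mul_exp_neg {x : ℝ} (hx : x ∈ Set.Ioo (0 : ℝ) 1) :
    treeSeries 0 (x * Real.exp (-x)) = 1 / (1 - x) := by
  have hl : AnalyticOnNhd ℝ (fun x => treeSeries 0 (x * Real.exp (-x))) (Set.Ioo 0 1) :=
    fun z hz => AnalyticAt.fun_comp (analyticAt_treeSeries 0 (abs_mul_exp_neg_lt hz.1.le hz.2))
      (by fun_prop)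
  have hr : AnalyticOnNhd ℝ (fun x : ℝ => 1 / (1 - x)) (Set.Ioo 0 1) :=
    fun z hz => analyticAt_const.div (by fun_prop) (by linarith [hz.2])
  refine hl.eqOn_of_preconnected_of_eventuallyEq hr isPreconnected_Ioo
    (z₀ := 1 / 16) (by norm_num) ?_ hx
  filter_upwards [Ioo_mem_nhds (a := (0 : ℝ)) (b := 1 / 8) (by norm_num) (by norm_num)] with z hz
  exact treeSeries_zero_of_lt_one_eighth hz.1 hz.2

/-- In the coordinate `y = x e⁻ˣ`, the operator `y d/dy` becomes `x / (1 - x) d/dx`. -/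
theorem treeSeries_succ_mul_exp_neg {k : ℕ} {P P' : ℝ → ℝ}
    (hP : ∀ x ∈ Set.Ioo (0 : ℝ) 1, treeSeries k (x * Real.exp (-x)) = P x)
    (hP' : ∀ x ∈ Set.Ioo (0 : ℝ) 1, HasDerivAt P (P' x) x) :
    ∀ x ∈ Set.Ioo (0 : ℝ) 1,
      treeSeries (k + 1) (x * Real.exp (-x)) = x / (1 - x) * P' x := by
  intro x hx
  have hx0 : x ≠ 0 := hx.1.ne'
  have hx1 : 1 - x ≠ 0 := by linarith [hx.2]
  have he : Real.exp (-x) ≠ 0 := (Real.exp_pos _).ne'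
  have hy : HasDerivAt (fun x : ℝ => x * Real.exp (-x)) ((1 - x) * Real.exp (-x)) x := by
    convert! (hasDerivAt_id x).mul (hasDerivAt_neg x).exp using 1
    simp only [id]
    ring
  have h := (hasDerivAt_treeSeries k (abs_mul_exp_neg_lt hx.1.le hx.2)
    (mul_ne_zero hx0 he)).comp x hy
  have h' := (hP' x hx).congr_of_eventuallyEq
    (Filter.eventuallyEq_of_mem (Ioo_mem_nhds hx.1 hx.2) hP)
  rw [← h.unique h']
  field_simp

theorem treeSeries_three_mul_exp_neg {x : ℝ} (hx : x ∈ Set.Ioo (0 : ℝ) 1) :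
    treeSeries 3 (x * Real.exp (-x)) = (x + 8 * x ^ 2 + 6 * x ^ 3) / (1 - x) ^ 7 := by
  have hsub (z : ℝ) : HasDerivAt (fun x : ℝ => 1 - x) (-1) z := by
    simpa using (hasDerivAt_id z).const_sub 1
  have hne {z : ℝ} (hz : z ∈ Set.Ioo (0 : ℝ) 1) : 1 - z ≠ 0 := by linarith [hz.2]
  have h1 : ∀ z ∈ Set.Ioo (0 : ℝ) 1,
      treeSeries 1 (z * Real.exp (-z)) = z / (1 - z) ^ 3 := by
    intro z hz
    rw [treeSeries_succ_mul_exp_neg (fun _ => treeSeries_zero_mul_exp_neg)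
      (fun z hz => (hasDerivAt_const z (1 : ℝ)).div (hsub z) (hne hz)) z hz]
    have := hne hz
    field_simp
    ring
  have h2 : ∀ z ∈ Set.Ioo (0 : ℝ) 1,
      treeSeries 2 (z * Real.exp (-z)) = (z + 2 * z ^ 2) / (1 - z) ^ 5 := by
    intro z hz
    rw [treeSeries_succ_mul_exp_neg h1 (fun z hz => (hasDerivAt_id z).div ((hsub z).pow 3)
      (pow_ne_zero 3 (hne hz))) z hz]
    have := hne hz
    simp only [id]
    field_simp
    push_cast
    ring
  rw [treeSeries_succ_mul_exp_neg h2 (fun z hz =>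
    ((hasDerivAt_id z).add ((hasDerivAt_pow 2 z).const_mul 2)).div ((hsub z).pow 5)
      (pow_ne_zero 5 (hne hz))) x hx]
  have := hne hx
  simp only [id, Pi.add_apply]
  field_simp
  push_cast
  ring

/-- for `0 ≤ x < 1`,
`∑_{D=1}^∞ (D^{D+3}/D!)·(x·e^{−x})^D = (x + 8x² + 6x³)/(1−x)^7`. -/
theorem stmt11 (x : ℝ) (hx0 : 0 ≤ x) (hx1 : x < 1) :
    HasSum
      (fun n : ℕ =>
        ((n + 1 : ℕ) ^ ((n + 1) + 3) / (n + 1).factorial : ℝ) * (x * Real.exp (-x)) ^ (n + 1))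
      ((x + 8 * x ^ 2 + 6 * x ^ 3) / (1 - x) ^ 7) := by
  rcases hx0.eq_or_lt with rfl | hpos
  · simp
  have h := (summable_treeSeries 3 (abs_mul_exp_neg_lt hx0 hx1)).hasSum
  rw [← treeSeries, treeSeries_three_mul_exp_neg ⟨hpos, hx1⟩] at h
  rw [← hasSum_nat_add_iff' 1] at h
  simpa using h
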